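/- arXiv:2301.00633 — 2 statements merged into one kernel-verified Lean document; each statement's English description precedes it below -/
import Mathlib

section
/- Let d ≥ 1, n = 2^d, and let M = M_d^{m_0,…,m_{n−1}} be a Pascal-like matrix. For all integers i, j with 0 < i < n and 0 ≤ j < n−1: if m_j = m_{j+1} then M_{i,j} = M_{i−1,j} + M_{i,j+1}, and if m_j = m_{j+1} + 1 then M_{i,j} = M_{i−1,j} + M_{i−1,j+1}, where + is addition in 𝔽₂. -/
/-- Entries of the Pascal-triangle matrix `M_d` (block recursive definition),
indexed by natural numbers. -/
def MdEnt : ℕ → ℕ → ℕ → ZMod 2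
  | 0, _, _ => 1
  | d+1, i, j =>
    if i < 2 ^ d then
      if j < 2 ^ d then MdEnt d i j else MdEnt d i (j - 2 ^ d)
    else
      if j < 2 ^ d then 0 else MdEnt d (i - 2 ^ d) (j - 2 ^ d)

/-- The matrix `M_d` over `𝔽₂`: `M_0 = (1)` and `M_{d+1} = [[M_d, M_d],[0, M_d]]`. -/
def Md (d : ℕ) : Matrix (Fin (2 ^ d)) (Fin (2 ^ d)) (ZMod 2) :=
  Matrix.of fun i j => MdEnt d (i : ℕ) (j : ℕ)

/-- The `s × t` array `P` occurs at position `(k, l)` in the toroidal array `A`. -/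
def Occurs {N s t : ℕ} (A : ZMod N → ZMod N → ZMod 2)
    (P : Fin s → Fin t → ZMod 2) (k l : ZMod N) : Prop :=
  ∀ (i : Fin s) (j : Fin t), A (k + ((i : ℕ) : ZMod N)) (l + ((j : ℕ) : ZMod N)) = P i j

/-- The toroidal array `A` of size `N × N` is `(s,t,p,q)`-perfect. -/
def IsPerfect (N s t p q : ℕ) (A : ZMod N → ZMod N → ZMod 2) : Prop :=
  ∀ (P : Fin s → Fin t → ZMod 2) (a b : ℕ), a < p → b < q →
    ∃! kl : Fin N × Fin N,
      (kl.1 : ℕ) % p = a ∧ (kl.2 : ℕ) % q = b ∧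
        Occurs A P (((kl.1 : ℕ) : ZMod N)) (((kl.2 : ℕ) : ZMod N))

/-- `B` is an aligned subarray of `A` of size `L × L` (where `L` divides `N`). -/
def IsAlignedSub (N L : ℕ) (A : ZMod N → ZMod N → ZMod 2)
    (B : ZMod L → ZMod L → ZMod 2) : Prop :=
  ∃ p q : ℕ, p < N / L ∧ q < N / L ∧
    ∀ (x y : Fin L),
      B ((x : ℕ) : ZMod L) ((y : ℕ) : ZMod L) =
        A (((p * L + (x : ℕ) : ℕ) : ZMod N)) (((q * L + (y : ℕ) : ℕ) : ZMod N))

/-- Nestedness of an `(n,n,n,n)`-perfect toroidal array of size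
`n·2^{n²/2} × n·2^{n²/2}`. -/
def IsNested (n : ℕ)
    (A : ZMod (n * 2 ^ (n ^ 2 / 2)) → ZMod (n * 2 ^ (n ^ 2 / 2)) → ZMod 2) : Prop :=
  ∀ k, 1 ≤ k → k ≤ n →
    ∀ B : ZMod (n * 2 ^ (n * k / 2)) → ZMod (n * 2 ^ (n * k / 2)) → ZMod 2,
      IsAlignedSub (n * 2 ^ (n ^ 2 / 2)) (n * 2 ^ (n * k / 2)) A B →
        IsPerfect (n * 2 ^ (n * k / 2)) k n n n B

/-- A nested `(n,n,n,n)`-perfect toroidal array. -/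
def IsNestedPerfect (n : ℕ)
    (A : ZMod (n * 2 ^ (n ^ 2 / 2)) → ZMod (n * 2 ^ (n ^ 2 / 2)) → ZMod 2) : Prop :=
  IsPerfect (n * 2 ^ (n ^ 2 / 2)) n n n n A ∧ IsNested n A

/-- `σ`: rotate a column vector downward by one step,
`(a_1,…,a_n) ↦ (a_n,a_1,…,a_{n-1})`. -/
def sigmaStep {n : ℕ} [NeZero n] (C : Fin n → ZMod 2) : Fin n → ZMod 2 :=
  fun i => C (i - 1)

instance instNeZeroTwoPow (d : ℕ) : NeZero (2 ^ d) := ⟨(Nat.two_pow_pos d).ne'⟩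

/-- Admissibility of a sequence of rotation amounts `m_0,…,m_{n-1}`:
`m_{n-1} = 0` and `m_{i+1} ≤ m_i ≤ m_{i+1} + 1`. -/
def Admissible {n : ℕ} (m : Fin n → ℕ) : Prop :=
  (∀ i : Fin n, (i : ℕ) = n - 1 → m i = 0) ∧
  ∀ i j : Fin n, (j : ℕ) = (i : ℕ) + 1 → m j ≤ m i ∧ m i ≤ m j + 1

/-- The Pascal-like matrix `M_d^{m_0,…,m_{n-1}}`: column `j` of `M_d`
rotated by `σ^{m_j}`. -/
def pascalLike (d : ℕ) (m : Fin (2 ^ d) → ℕ) :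
    Matrix (Fin (2 ^ d)) (Fin (2 ^ d)) (ZMod 2) :=
  Matrix.of fun i j => (sigmaStep^[m j] (fun r => Md d r j)) i

/-- `M_{i,j}` lies in the upper border of `M`: it is the topmost `1` of its column. -/
def UpperBorder {n : ℕ} (M : Matrix (Fin n) (Fin n) (ZMod 2)) (i j : Fin n) : Prop :=
  M i j = 1 ∧ ∀ r : Fin n, r < i → M r j = 0

/-- The enumeration `N_k` of all `n × n` matrices over `𝔽₂`:
entry `(i,j)` of `N_k` is the binary digit of `k` at position `n²−1−(i·n+j)`. -/
def Nmat (n k : ℕ) : Matrix (Fin n) (Fin n) (ZMod 2) :=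
  Matrix.of fun i j =>
    if Nat.testBit k (n ^ 2 - 1 - ((i : ℕ) * n + (j : ℕ))) then 1 else 0

/-- The integer whose binary digit at position `t` is the digit of `k` at position `2t`. -/
def evenPart (k : ℕ) : ℕ :=
  ∑ t ∈ Finset.range k, if Nat.testBit k (2 * t) then 2 ^ t else 0

/-- The integer whose binary digit at position `t` is the digit of `k` at position `2t+1`. -/
def oddPart (k : ℕ) : ℕ :=
  ∑ t ∈ Finset.range k, if Nat.testBit k (2 * t + 1) then 2 ^ t else 0

/-- The integer whose odd-position binary digits are those of `l` and whose
even-position binary digits are those of `m`; inverse of `k ↦ (oddPart k, evenPart k)`. -/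
def joinOE (l m : ℕ) : ℕ :=
  ∑ t ∈ Finset.range (l + m + 1),
    ((if Nat.testBit l t then 2 ^ (2 * t + 1) else 0) +
      (if Nat.testBit m t then 2 ^ (2 * t) else 0))

/-- The Pascal toroidal array `A_d` of size `n·2^{n²/2} × n·2^{n²/2}` (`n = 2^d`):
the matrix `M_d·N_k` is placed with upper left corner at `(odd(k)·n, even(k)·n)`. -/
def pascalArray (d : ℕ) :
    ZMod (2 ^ d * 2 ^ ((2 ^ d) ^ 2 / 2)) → ZMod (2 ^ d * 2 ^ ((2 ^ d) ^ 2 / 2)) → ZMod 2 :=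
  fun x y =>
    (Md d * Nmat (2 ^ d) (joinOE (x.val / 2 ^ d) (y.val / 2 ^ d)))
      ⟨x.val % 2 ^ d, Nat.mod_lt _ (Nat.two_pow_pos d)⟩
      ⟨y.val % 2 ^ d, Nat.mod_lt _ (Nat.two_pow_pos d)⟩

/-- The `(n,n,n,n)`-affine toroidal array determined by the Pascal-like matrix
given by rotations `m` and the matrix `Z`: the matrix `M·N_k ⊕ Z` is placed with
upper left corner at `(odd(k)·n, even(k)·n)`. -/
def affineArray (d : ℕ) (m : Fin (2 ^ d) → ℕ)
    (Z : Matrix (Fin (2 ^ d)) (Fin (2 ^ d)) (ZMod 2)) :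
    ZMod (2 ^ d * 2 ^ ((2 ^ d) ^ 2 / 2)) → ZMod (2 ^ d * 2 ^ ((2 ^ d) ^ 2 / 2)) → ZMod 2 :=
  fun x y =>
    (pascalLike d m * Nmat (2 ^ d) (joinOE (x.val / 2 ^ d) (y.val / 2 ^ d)) + Z)
      ⟨x.val % 2 ^ d, Nat.mod_lt _ (Nat.two_pow_pos d)⟩
      ⟨y.val % 2 ^ d, Nat.mod_lt _ (Nat.two_pow_pos d)⟩

theorem MdEnt_zero_left (d j : ℕ) : MdEnt d 0 j = 1 := by
  induction d generalizing j with
  | zero => simp [MdEnt]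
  | succ d ih => simp [MdEnt, ih]

theorem MdEnt_zero_right (d i : ℕ) (h0 : 0 < i) (hi : i < 2 ^ d) : MdEnt d i 0 = 0 := by
  induction d generalizing i with
  | zero => simp at hi; omega
  | succ d ih =>
    simp only [MdEnt]
    by_cases h : i < 2 ^ d
    · simp [h, ih i h0 h]
    · simp [h]

theorem MdEnt_last_col (d i : ℕ) (hi : i < 2 ^ d) : MdEnt d i (2 ^ d - 1) = 1 := by
  induction d generalizing i with
  | zero => simp [MdEnt]
  | succ d ih =>
    have hp : 0 < 2 ^ d := Nat.two_pow_pos d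
    rw [pow_succ] at hi ⊢
    have h1 : ¬ (2 ^ d * 2 - 1 < 2 ^ d) := by omega
    have h2 : 2 ^ d * 2 - 1 - 2 ^ d = 2 ^ d - 1 := by omega
    simp only [MdEnt, h1, h2, if_false]
    split_ifs with h
    · exact ih i h
    · exact ih _ (by omega)

theorem MdEnt_last_row (d j : ℕ) (hj : j < 2 ^ d - 1) : MdEnt d (2 ^ d - 1) j = 0 := by
  induction d generalizing j with
  | zero => simp at hj
  | succ d ih =>
    have hp : 0 < 2 ^ d := Nat.two_pow_pos d
    rw [pow_succ] at hj ⊢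
    have h1 : ¬ (2 ^ d * 2 - 1 < 2 ^ d) := by omega
    have h2 : 2 ^ d * 2 - 1 - 2 ^ d = 2 ^ d - 1 := by omega
    simp only [MdEnt, h1, h2, if_false]
    split_ifs with h
    · rfl
    · exact ih _ (by omega)

theorem MdEnt_rec (d i j : ℕ) (hi : i + 1 < 2 ^ d) (hj : j + 1 < 2 ^ d) :
    MdEnt d (i + 1) j = MdEnt d i j + MdEnt d (i + 1) (j + 1) := by
  induction d generalizing i j with
  | zero => simp at hi
  | succ d ih =>
    have hp : 0 < 2 ^ d := Nat.two_pow_pos d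
    have two : (1 : ZMod 2) + 1 = 0 := by decide
    rw [pow_succ] at hi hj
    rcases lt_trichotomy (j + 1) (2 ^ d) with hjc | hjc | hjc
    · have j1 : j < 2 ^ d := by omega
      simp only [MdEnt, hjc, j1, if_true]
      rcases lt_trichotomy (i + 1) (2 ^ d) with hic | hic | hic
      · have i1 : i < 2 ^ d := by omega
        simp only [hic, i1, if_true]
        exact ih i j hic hjc
      · have i1 : i < 2 ^ d := by omega
        have i2 : ¬ (i + 1 < 2 ^ d) := by omega
        have : i = 2 ^ d - 1 := by omega
        simp only [i1, i2, if_true, if_false]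
        rw [this, MdEnt_last_row d j (by omega)]; simp
      · have i1 : ¬ (i < 2 ^ d) := by omega
        have i2 : ¬ (i + 1 < 2 ^ d) := by omega
        simp [i1, i2]
    · have j1 : j < 2 ^ d := by omega
      have j2 : ¬ (j + 1 < 2 ^ d) := by omega
      have j3 : j + 1 - 2 ^ d = 0 := by omega
      have j4 : j = 2 ^ d - 1 := by omega
      simp only [MdEnt, j1, j2, j3, if_true, if_false]
      rw [j4]
      rcases lt_trichotomy (i + 1) (2 ^ d) with hic | hic | hic
      · have i1 : i < 2 ^ d := by omega
        simp only [hic, i1, if_true]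
        rw [MdEnt_last_col d _ hic, MdEnt_last_col d _ i1, MdEnt_zero_right d _ (by omega) hic]
        simp
      · have i1 : i < 2 ^ d := by omega
        have i2 : ¬ (i + 1 < 2 ^ d) := by omega
        have i3 : i + 1 - 2 ^ d = 0 := by omega
        simp only [i1, i2, i3, if_true, if_false]
        rw [MdEnt_last_col d _ i1, MdEnt_zero_left, two]
      · have i1 : ¬ (i < 2 ^ d) := by omega
        have i2 : ¬ (i + 1 < 2 ^ d) := by omega
        simp only [i1, i2, if_false]
        rw [MdEnt_zero_right d _ (by omega) (by omega)]; simp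
    · have j1 : ¬ (j < 2 ^ d) := by omega
      have j2 : ¬ (j + 1 < 2 ^ d) := by omega
      have j3 : j + 1 - 2 ^ d = j - 2 ^ d + 1 := by omega
      simp only [MdEnt, j1, j2, j3, if_false]
      rcases lt_trichotomy (i + 1) (2 ^ d) with hic | hic | hic
      · have i1 : i < 2 ^ d := by omega
        simp only [hic, i1, if_true]
        exact ih _ _ hic (by omega)
      · have i1 : i < 2 ^ d := by omega
        have i2 : ¬ (i + 1 < 2 ^ d) := by omega
        have i3 : i + 1 - 2 ^ d = 0 := by omega
        have i4 : i = 2 ^ d - 1 := by omega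
        simp only [i1, i2, i3, if_true, if_false]
        rw [i4, MdEnt_last_row d _ (by omega), MdEnt_zero_left, MdEnt_zero_left]; simp
      · have i1 : ¬ (i < 2 ^ d) := by omega
        have i2 : ¬ (i + 1 < 2 ^ d) := by omega
        have i3 : i + 1 - 2 ^ d = i - 2 ^ d + 1 := by omega
        simp only [i1, i2, i3, if_false]
        exact ih _ _ (by omega) (by omega)

/-- Cyclic recurrence for `M_d`. -/
theorem Md_rec (d : ℕ) (r : Fin (2 ^ d)) (j : ℕ) (hj : j + 1 < 2 ^ d) :
    Md d r ⟨j, by omega⟩ = Md d (r - 1) ⟨j, by omega⟩ + Md d r ⟨j + 1, hj⟩ := by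
  have hone : ((1 : Fin (2 ^ d)) : ℕ) = 1 := by
    rw [Fin.val_one', Nat.mod_eq_of_lt (by omega)]
  have hr := r.isLt
  have hv : ((r - 1 : Fin (2 ^ d)) : ℕ) = (2 ^ d - 1 + r) % 2 ^ d := by
    rw [Fin.val_sub, hone]
  simp only [Md, Matrix.of_apply, hv]
  rcases Nat.eq_zero_or_pos (r : ℕ) with h | h
  · rw [h, add_zero, Nat.mod_eq_of_lt (by omega), MdEnt_last_row d j (by omega),
      MdEnt_zero_left, MdEnt_zero_left, zero_add]
  · obtain ⟨s, hs⟩ : ∃ s, (r : ℕ) = s + 1 := ⟨r - 1, by omega⟩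
    have : (2 ^ d - 1 + (r : ℕ)) % 2 ^ d = s := by
      have : 2 ^ d - 1 + (r : ℕ) = s + 2 ^ d := by omega
      rw [this, Nat.add_mod_right, Nat.mod_eq_of_lt (by omega)]
    rw [this, hs]
    exact MdEnt_rec d s j (by omega) hj

open scoped Fin.CommRing in
theorem sigmaStep_iter {n : ℕ} [NeZero n] (k : ℕ) (C : Fin n → ZMod 2) (i : Fin n) :
    (sigmaStep^[k] C) i = C (i - (k : Fin n)) := by
  induction k generalizing i with
  | zero => simp
  | succ k ih =>
    rw [Function.iterate_succ_apply']
    simp only [sigmaStep, ih]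
    congr 1
    push_cast
    ring

/-- For a Pascal-like matrix `M = M_d^{m_0,…,m_{n−1}}` (`d ≥ 1`,
`n = 2^d`) and `0 < i < n`, `0 ≤ j < n−1`: if `m_j = m_{j+1}` then
`M_{i,j} = M_{i−1,j} + M_{i,j+1}`, and if `m_j = m_{j+1}+1` then
`M_{i,j} = M_{i−1,j} + M_{i−1,j+1}` (addition in `𝔽₂`). -/
theorem pascalLike_recurrence (d : ℕ) (hd : 1 ≤ d) (m : Fin (2 ^ d) → ℕ)
    (hm : Admissible m) (i j : ℕ) (hi0 : 0 < i) (hi : i < 2 ^ d) (hj : j < 2 ^ d - 1) :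
    (m ⟨j, by omega⟩ = m ⟨j + 1, by omega⟩ →
      pascalLike d m ⟨i, hi⟩ ⟨j, by omega⟩ =
        pascalLike d m ⟨i - 1, by omega⟩ ⟨j, by omega⟩ +
          pascalLike d m ⟨i, hi⟩ ⟨j + 1, by omega⟩) ∧
    (m ⟨j, by omega⟩ = m ⟨j + 1, by omega⟩ + 1 →
      pascalLike d m ⟨i, hi⟩ ⟨j, by omega⟩ =
        pascalLike d m ⟨i - 1, by omega⟩ ⟨j, by omega⟩ +
          pascalLike d m ⟨i - 1, by omega⟩ ⟨j + 1, by omega⟩) := by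
  have hj1 : j + 1 < 2 ^ d := by omega
  have hpred : (⟨i - 1, by omega⟩ : Fin (2 ^ d)) = ⟨i, hi⟩ - 1 := by
    apply Fin.ext
    rw [Fin.val_sub, Fin.val_one', Nat.mod_eq_of_lt (by omega : 1 < 2 ^ d)]
    have : 2 ^ d - 1 + i = i - 1 + 2 ^ d := by omega
    simp only [this, Nat.add_mod_right]
    rw [Nat.mod_eq_of_lt (by omega)]
  rw [hpred]
  open scoped Fin.CommRing in
  constructor
  · intro h
    simp only [pascalLike, Matrix.of_apply, sigmaStep_iter, h]
    rw [Md_rec d _ j hj1]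
    congr 2
    ring
  · intro h
    simp only [pascalLike, Matrix.of_apply, sigmaStep_iter, h]
    rw [Md_rec d _ j hj1]
    push_cast
    congr 2 <;> ring
end

section
/- Let d ≥ 0, n = 2^d, and let M = M_d^{m_0,…,m_{n−1}} be a Pascal-like matrix. For every column index 0 ≤ i < n: M_{m_i, i} = 1 and M_{m_i+i, i} = 1, and M_{r,i} = 0 for every row index r with r < m_i or r > m_i + i. That is, the topmost 1 of column i is in row m_i (the upper border) and the bottommost 1 of column i is in row m_i + i (the lower border). -/
theorem MdEnt_zero_row (d : ℕ) : ∀ j, MdEnt d 0 j = 1 := by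
  induction d with
  | zero => intro j; rfl
  | succ d ih =>
    intro j
    have := Nat.two_pow_pos d
    simp [MdEnt, ih]

theorem MdEnt_diag (d : ℕ) : ∀ j, MdEnt d j j = 1 := by
  induction d with
  | zero => intro j; rfl
  | succ d ih =>
    intro j
    by_cases h : j < 2 ^ d <;> simp [MdEnt, ih, h]

theorem MdEnt_lower (d : ℕ) : ∀ i j, i < 2 ^ d → j < i → MdEnt d i j = 0 := by
  induction d with
  | zero => intro i j h1 h2; simp at h1; omega
  | succ d ih =>
    intro i j h1 h2
    rw [pow_succ] at h1
    simp only [MdEnt]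
    split_ifs with h3 h4 h4
    · exact ih _ _ h3 h2
    · omega
    · rfl
    · exact ih _ _ (by omega) (by omega)

theorem sigma_iter {n : ℕ} [NeZero n] (k : ℕ) : ∀ (C : Fin n → ZMod 2) (s r : Fin n),
    ((s : ℕ) + k) % n = r → sigmaStep^[k] C r = C s := by
  induction k with
  | zero =>
    intro C s r h
    rw [add_zero, Nat.mod_eq_of_lt s.isLt] at h
    rw [Fin.ext h]; rfl
  | succ k ih =>
    intro C s r h
    rw [Function.iterate_succ_apply, ih _ (s + 1) r]
    · simp [sigmaStep]
    · rw [← h, Fin.val_add, Fin.val_one']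
      simp only [Nat.add_mod_mod, Nat.mod_add_mod]
      congr 1; omega

theorem adm_bound {n : ℕ} (m : Fin n → ℕ) (hm : Admissible m) (k : ℕ) :
    ∀ i : Fin n, (i : ℕ) + k = n - 1 → m i + i ≤ n - 1 := by
  induction k with
  | zero => intro i h; have := hm.1 i (by omega); omega
  | succ k ih =>
    intro i h
    have h1 := ih ⟨i + 1, by omega⟩ (by simp only; omega)
    have h2 := (hm.2 i ⟨i + 1, by omega⟩ rfl).2
    simp only at h1
    omega

/-- For a Pascal-like matrix `M = M_d^{m_0,…,m_{n−1}}` (`n = 2^d`) and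
every column `i`: the topmost `1` of column `i` is in row `m_i` and the bottommost
`1` is in row `m_i + i`; all entries above row `m_i` or below row `m_i + i` are `0`. -/
theorem pascalLike_borders (d : ℕ) (m : Fin (2 ^ d) → ℕ) (hm : Admissible m)
    (i : Fin (2 ^ d)) :
    (∀ r : Fin (2 ^ d), (r : ℕ) = m i → pascalLike d m r i = 1) ∧
    (∀ r : Fin (2 ^ d), (r : ℕ) = m i + (i : ℕ) → pascalLike d m r i = 1) ∧
    (∀ r : Fin (2 ^ d), ((r : ℕ) < m i ∨ m i + (i : ℕ) < (r : ℕ)) →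
      pascalLike d m r i = 0) := by
  have hb := adm_bound m hm (2 ^ d - 1 - i) i (by have := i.isLt; omega)
  have hp := Nat.two_pow_pos d
  have key : ∀ s r : Fin (2 ^ d), ((s : ℕ) + m i) % 2 ^ d = r →
      pascalLike d m r i = MdEnt d s i := fun s r h =>
    sigma_iter (m i) (fun r => Md d r i) s r h
  refine ⟨fun r hr => ?_, fun r hr => ?_, fun r hr => ?_⟩
  · rw [key ⟨0, hp⟩ r (by rw [← Nat.mod_eq_of_lt r.isLt, hr]; simp)]
    exact MdEnt_zero_row d _
  · rw [key i r (by rw [← Nat.mod_eq_of_lt r.isLt, hr, add_comm])]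
    exact MdEnt_diag d _
  · rcases hr with hr | hr
    · rw [key ⟨r + 2 ^ d - m i, by omega⟩ r (by
        simp only
        rw [show (r : ℕ) + 2 ^ d - m i + m i = r + 2 ^ d by omega, Nat.add_mod_right,
          Nat.mod_eq_of_lt r.isLt])]
      exact MdEnt_lower d _ _ (by simp only; omega) (by simp only; omega)
    · have := r.isLt
      rw [key ⟨r - m i, by omega⟩ r (by
        simp only
        rw [show (r : ℕ) - m i + m i = r by omega, Nat.mod_eq_of_lt r.isLt])]
      exact MdEnt_lower d _ _ (by simp only; omega) (by simp only; omega)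
end
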